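/- arXiv:2206.10726 — 5 statements merged into one kernel-verified Lean document; each statement's English description precedes it below -/
import Mathlib

section
/- With Λ, Ω, u, v, κ, Λ̄, Ω̄, x, y, α, the Λ̄-action on Ω̄ and the set 𝒯 as in the context, let Γ̄ := Λ̄ ⋉ Ω̄ be the semidirect product for this action, with Λ̄ and Ω̄ (hence Λ, Ω, x, y) viewed inside Γ̄. Then for every triple (P, χ, ψ) ∈ 𝒯 there exists a 2-cocycle σ on Γ̄ with values in kˣ such that for all g ∈ Λ and h ∈ Ω: σ(g, h)·σ(h, g)⁻¹ = P(g, h), σ(g, y)·σ(y, g)⁻¹ = χ(g), and σ(x, h)·σ(h, x)⁻¹ = ψ(h). -/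
open SemidirectProduct Multiplicative

section AdjoinSquareRoot

variable {A B G : Type*} [CommGroup A] [Group B] [Group G]

lemma map_adjoin_eq (π : A × Multiplicative ℤ →* B) (a : A) (n : Multiplicative ℤ) :
    π (a, n) = π (a, 1) * π (1, ofAdd 1) ^ toAdd n := by
  rw [← map_zpow, ← map_mul]
  congr 1
  ext
  · simp
  · simp [← ofAdd_zsmul]

/-- A subgroup containing the image of `A` and the adjoined root is everything. -/
lemma mem_of_adjoin_generators {π : A × Multiplicative ℤ →* B} (hπ : Function.Surjective π)
    {S : Subgroup B} (hA : ∀ a, π (a, 1) ∈ S) (hx : π (1, ofAdd 1) ∈ S) (b : B) : b ∈ S := by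
  obtain ⟨⟨a, n⟩, rfl⟩ := hπ b
  rw [map_adjoin_eq]
  exact S.mul_mem (hA a) (S.zpow_mem hx _)

lemma hom_ext_of_adjoin_generators {π : A × Multiplicative ℤ →* B}
    (hπ : Function.Surjective π) {f g : B →* G} (hA : ∀ a, f (π (a, 1)) = g (π (a, 1)))
    (hx : f (π (1, ofAdd 1)) = g (π (1, ofAdd 1))) : f = g :=
  MonoidHom.ext fun b => mem_of_adjoin_generators (S := f.eqLocus g) hπ hA hx b

/-- The square of the adjoined root is the element it is a root of. -/
lemma adjoin_root_sq {π : A × Multiplicative ℤ →* B} {u : A}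
    (hker : π.ker = Subgroup.zpowers ((u, ofAdd (-2 : ℤ)) : A × Multiplicative ℤ)) :
    π (1, ofAdd 1) ^ 2 = π (u, 1) := by
  have h : π (u, ofAdd (-2 : ℤ)) = 1 := by
    rw [← MonoidHom.mem_ker, hker]
    exact Subgroup.mem_zpowers _
  rw [map_adjoin_eq, toAdd_ofAdd, zpow_neg, mul_inv_eq_one] at h
  rw [h]
  norm_cast

/-- The universal property of the group obtained by adjoining a square root of `u` to `A`. -/
lemma exists_hom_of_adjoin_root {π : A × Multiplicative ℤ →* B}
    (hπ : Function.Surjective π) {u : A}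
    (hker : π.ker = Subgroup.zpowers ((u, ofAdd (-2 : ℤ)) : A × Multiplicative ℤ))
    (f : A →* G) (t : G) (hcomm : ∀ a, Commute (f a) t) (ht : t ^ 2 = f u) :
    ∃ F : B →* G, (∀ a, F (π (a, 1)) = f a) ∧ F (π (1, ofAdd 1)) = t := by
  let F₀ : A × Multiplicative ℤ →* G :=
    f.noncommCoprod (zpowersHom G t) fun a n => by
      rw [zpowersHom_apply]
      exact (hcomm a).zpow_right _
  have hF₀ : π.ker ≤ F₀.ker := by
    rw [hker, Subgroup.zpowers_le, MonoidHom.mem_ker]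
    simp only [F₀, MonoidHom.noncommCoprod_apply, zpowersHom_apply, toAdd_ofAdd, zpow_neg,
      mul_inv_eq_one, ← ht]
    norm_cast
  refine ⟨π.liftOfSurjective hπ ⟨F₀, hF₀⟩, fun a => ?_, ?_⟩
  · rw [MonoidHom.liftOfRightInverse_comp_apply]
    simp [F₀]
  · rw [MonoidHom.liftOfRightInverse_comp_apply]
    simp [F₀]

end AdjoinSquareRoot

section Shear

variable {M N : Type*} [CommGroup M] [CommGroup N]

/-- The automorphism `(z, w) ↦ (z * F w, e w)` of `M × N`. -/
def shear (F : N →* M) (e : MulAut N) : MulAut (M × N) where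
  toFun p := (p.1 * F p.2, e p.2)
  invFun p := (p.1 * (F (e⁻¹ p.2))⁻¹, e⁻¹ p.2)
  left_inv p := by simp
  right_inv p := by simp
  map_mul' p q := by simp [mul_mul_mul_comm]

@[simp]
lemma shear_apply (F : N →* M) (e : MulAut N) (p : M × N) :
    shear F e p = (p.1 * F p.2, e p.2) := rfl

lemma shear_mul (F F' : N →* M) (e e' : MulAut N) :
    shear F e * shear F' e' = shear (F' * F.comp e'.toMonoidHom) (e * e') := by
  ext p <;> simp [mul_assoc]

lemma shear_one : shear (1 : N →* M) 1 = 1 := by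
  ext p <;> simp

lemma shear_left_injective (e : MulAut N) :
    Function.Injective fun F : N →* M => shear F e := fun F F' h => by
  ext w
  simpa using congrArg Prod.fst (DFunLike.congr_fun h (1, w))

lemma shear_inv (F : N →* M) (e : MulAut N) :
    (shear F e)⁻¹ = shear (F.comp e⁻¹.toMonoidHom)⁻¹ e⁻¹ := by
  rw [inv_eq_iff_mul_eq_one, shear_mul, mul_inv_cancel, ← shear_one]
  congr 1
  ext w
  simp

variable (M N) in
/-- Pairs of a shear together with the automorphism it induces on the second factor. -/
def shearSubgroup : Subgroup (MulAut (M × N) × MulAut N) where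
  carrier := {p | ∃ F : N →* M, p.1 = shear F p.2}
  one_mem' := ⟨1, shear_one.symm⟩
  mul_mem' := by
    rintro p q ⟨F, hF⟩ ⟨F', hF'⟩
    exact ⟨_, by rw [Prod.fst_mul, hF, hF', shear_mul, Prod.snd_mul]⟩
  inv_mem' := by
    rintro p ⟨F, hF⟩
    exact ⟨_, by rw [Prod.fst_inv, hF, shear_inv, Prod.snd_inv]⟩

end Shear

/-- A crossed homomorphism from `H` to the characters of `N` gives a 2-cocycle on `N ⋊ H`. -/
lemma crossedHom_cocycle {M N H : Type*} [CommGroup M] [CommGroup N] [Group H]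
    {φ : H →* MulAut N} {F : H → N →* M}
    (hF : ∀ g g', F (g * g') = F g' * (F g).comp (φ g').toMonoidHom) (a b c : N ⋊[φ] H) :
    F a.right b.left * F (a * b).right c.left =
      F a.right (b * c).left * F b.right c.left := by
  simp [hF, mul_comm, mul_left_comm]

/-- Every triple `(P, χ, ψ) ∈ 𝒯` is realized by a 2-cocycle on the semidirect
product `Γ̄ = Λ̄ ⋉ Ω̄`. -/
theorem stmt_14 {k : Type*} [Field k] [IsAlgClosed k] [CharZero k]
    {Λ Ω : Type*} [CommGroup Λ] [CommGroup Ω]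
    (u : Λ) (v κ : Ω) (hκ2 : κ ^ 2 = 1) (hκ1 : κ ≠ 1)
    {Λb Ωb : Type*} [CommGroup Λb] [CommGroup Ωb]
    (πΛ : Λ × Multiplicative ℤ →* Λb) (hπΛ : Function.Surjective πΛ)
    (hkerΛ : πΛ.ker =
      Subgroup.zpowers ((u, Multiplicative.ofAdd (-2 : ℤ)) : Λ × Multiplicative ℤ))
    (πΩ : Ω × Multiplicative ℤ →* Ωb) (hπΩ : Function.Surjective πΩ)
    (hkerΩ : πΩ.ker =
      Subgroup.zpowers ((v, Multiplicative.ofAdd (-2 : ℤ)) : Ω × Multiplicative ℤ))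
    (φ : Λb →* MulAut Ωb)
    (hφΛ : ∀ a : Λ, φ (πΛ (a, 1)) = 1)
    (hφΩ : ∀ b : Ω,
      φ (πΛ (1, Multiplicative.ofAdd 1)) (πΩ (b, 1)) = πΩ (b, 1))
    (hφy : φ (πΛ (1, Multiplicative.ofAdd 1)) (πΩ (1, Multiplicative.ofAdd 1)) =
      πΩ (κ, 1) * πΩ (1, Multiplicative.ofAdd 1))
    (P : Λ → Ω → kˣ) (χ : Λ →* kˣ) (ψ : Ω →* kˣ)
    (hP₁ : ∀ a a' : Λ, ∀ b : Ω, P (a * a') b = P a b * P a' b)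
    (hP₂ : ∀ a : Λ, ∀ b b' : Ω, P a (b * b') = P a b * P a b')
    (hT₁ : ψ v * ψ κ = χ u)
    (hT₂ : ∀ a : Λ, P a κ = 1)
    (hT₃ : ∀ a : Λ, χ a ^ 2 = P a v)
    (hT₄ : ∀ b : Ω, ψ b ^ 2 = P u b) :
    ∃ σ : (Ωb ⋊[φ] Λb) → (Ωb ⋊[φ] Λb) → kˣ,
      (∀ a b c : Ωb ⋊[φ] Λb, σ a b * σ (a * b) c = σ a (b * c) * σ b c) ∧
      (∀ (a : Λ) (b : Ω),
        σ (SemidirectProduct.inr (πΛ (a, 1))) (SemidirectProduct.inl (πΩ (b, 1))) *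
          (σ (SemidirectProduct.inl (πΩ (b, 1)))
            (SemidirectProduct.inr (πΛ (a, 1))))⁻¹ = P a b) ∧
      (∀ a : Λ,
        σ (SemidirectProduct.inr (πΛ (a, 1)))
            (SemidirectProduct.inl (πΩ (1, Multiplicative.ofAdd 1))) *
          (σ (SemidirectProduct.inl (πΩ (1, Multiplicative.ofAdd 1)))
            (SemidirectProduct.inr (πΛ (a, 1))))⁻¹ = χ a) ∧
      (∀ b : Ω,
        σ (SemidirectProduct.inr (πΛ (1, Multiplicative.ofAdd 1)))
            (SemidirectProduct.inl (πΩ (b, 1))) *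
          (σ (SemidirectProduct.inl (πΩ (b, 1)))
            (SemidirectProduct.inr (πΛ (1, Multiplicative.ofAdd 1))))⁻¹ = ψ b) := by
  set x := πΛ (1, ofAdd 1)
  set y := πΩ (1, ofAdd 1) with hy
  have hchar (a : Λ) : ∃ F : Ωb →* kˣ, (∀ b, F (πΩ (b, 1)) = P a b) ∧ F y = χ a :=
    exists_hom_of_adjoin_root hπΩ hkerΩ (MonoidHom.mk' (P a) (hP₂ a)) (χ a)
      (fun _ => Commute.all _ _) (hT₃ a)
  choose F hFΩ hFy using hchar
  obtain ⟨c, hc⟩ : ∃ c : kˣ, c ^ 2 = ψ v := by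
    obtain ⟨z, hz⟩ := IsAlgClosed.exists_pow_nat_eq (ψ v : k) (n := 2) two_pos
    have hz0 : z ≠ 0 := by
      rintro rfl
      exact (ψ v).ne_zero (by simpa using hz.symm)
    exact ⟨Units.mk0 z hz0, Units.ext (by simpa using hz)⟩
  obtain ⟨Fx, hFxΩ, hFxy⟩ := exists_hom_of_adjoin_root hπΩ hkerΩ ψ c
    (fun _ => Commute.all _ _) hc
  rw [← hy] at hFxy
  have hF_mul (a a' : Λ) : F (a * a') = F a' * F a :=
    hom_ext_of_adjoin_generators hπΩ (fun b => by simp [hFΩ, hP₁, mul_comm])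
      (by simp [← hy, hFy, mul_comm])
  have hF_comp (a : Λ) : (F a).comp (φ x).toMonoidHom = F a :=
    hom_ext_of_adjoin_generators hπΩ (fun b => by simp [hφΩ])
      (by simp [← hy, hφy, hFΩ, hT₂])
  have hFx_sq : Fx * Fx.comp (φ x).toMonoidHom = F u :=
    hom_ext_of_adjoin_generators hπΩ
      (fun b => by simp [hφΩ, hFΩ, hFxΩ, ← hT₄, sq])
      (by
        simp only [← hy, MonoidHom.mul_apply, MonoidHom.comp_apply, MulEquiv.coe_toMonoidHom,
          hφy, map_mul, hFxΩ, hFxy, hFy, ← hT₁, ← hc, sq]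
        exact mul_left_comm c (ψ κ) c |>.trans (mul_comm _ _))
  let f : Λ →* MulAut (kˣ × Ωb) := MonoidHom.mk' (fun a => shear (F a) 1) fun a a' => by
    rw [shear_mul, hF_mul]
    rfl
  obtain ⟨T, hTΛ, hTx⟩ := exists_hom_of_adjoin_root hπΛ hkerΛ f (shear Fx (φ x))
    (fun a => by
      change shear _ _ * shear _ _ = shear _ _ * shear _ _
      rw [shear_mul, shear_mul, hF_comp, one_mul, mul_one, mul_comm Fx]
      rfl)
    (by rw [sq, shear_mul, hFx_sq, ← map_mul, ← sq, adjoin_root_sq hkerΛ, hφΛ]; rfl)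
  have hshear (g : Λb) : ∃ E : Ωb →* kˣ, T g = shear E (φ g) :=
    mem_of_adjoin_generators (S := (shearSubgroup kˣ Ωb).comap (T.prod φ)) hπΛ
      (fun a => ⟨F a, by simp [hTΛ, hφΛ, f]⟩) ⟨Fx, hTx⟩ g
  choose E hE using hshear
  have hE_mul (g g' : Λb) : E (g * g') = E g' * (E g).comp (φ g').toMonoidHom :=
    shear_left_injective (φ (g * g')) (by
      dsimp only
      rw [← hE, map_mul, map_mul, ← shear_mul, ← hE, ← hE])
  have hE_one : E 1 = 1 := shear_left_injective (φ 1) (by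
    dsimp only
    rw [← hE, map_one, map_one, shear_one])
  have hEΛ (a : Λ) : E (πΛ (a, 1)) = F a :=
    shear_left_injective (φ (πΛ (a, 1))) (by
      dsimp only
      rw [← hE, hTΛ, hφΛ]
      rfl)
  have hEx : E x = Fx := shear_left_injective (φ x) ((hE x).symm.trans hTx)
  refine ⟨fun a b => E a.right b.left, crossedHom_cocycle hE_mul, fun a b => ?_, fun a => ?_,
    fun b => ?_⟩
  · simp [hEΛ, hFΩ]
  · simp [hEΛ, hFy]
  · simp [hEx, hFxΩ]
end

section
/- Let G be a finite group and Γ a central subgroup of G such that the quotient G/Γ is isomorphic to (ℤ/2ℤ) × (ℤ/2ℤ). Then the set H of elements of G of odd order is a subgroup contained in Γ, and for any Sylow 2-subgroup P of G the multiplication map P × H → G, (p, h) ↦ p·h, is a group isomorphism. Moreover, for k an algebraically closed field of characteristic 0, there is a group isomorphism H²(G, kˣ) ≅ H²(P, kˣ) × H²(H, kˣ). -/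
/-- The subgroup of 2-cocycles of `G` with values in a commutative group `M`
(with trivial action). -/
def cocycles2 (G M : Type*) [Group G] [CommGroup M] : Subgroup (G → G → M) where
  carrier := {σ | ∀ a b c : G, σ a b * σ (a * b) c = σ a (b * c) * σ b c}
  one_mem' := by intro a b c; simp
  mul_mem' := by
    intro σ τ hσ hτ a b c
    simp only [Pi.mul_apply]
    rw [mul_mul_mul_comm, hσ a b c, hτ a b c, mul_mul_mul_comm]
  inv_mem' := by
    intro σ hσ a b c
    simp only [Pi.inv_apply]
    rw [← mul_inv, hσ a b c, mul_inv]

/-- The subgroup of 2-coboundaries of `G` with values in a commutative group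
`M`. -/
def coboundaries2 (G M : Type*) [Group G] [CommGroup M] : Subgroup (G → G → M) where
  carrier := {σ | ∃ η : G → M, ∀ a b : G, σ a b = η a * η b * (η (a * b))⁻¹}
  one_mem' := ⟨fun _ => 1, by intro a b; simp⟩
  mul_mem' := by
    rintro σ τ ⟨η₁, h₁⟩ ⟨η₂, h₂⟩
    refine ⟨fun x => η₁ x * η₂ x, fun a b => ?_⟩
    simp only [Pi.mul_apply, h₁ a b, h₂ a b, mul_inv]
    rw [mul_mul_mul_comm (η₁ a * η₁ b) _ (η₂ a * η₂ b),
      mul_mul_mul_comm (η₁ a) (η₁ b) (η₂ a) (η₂ b)]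
  inv_mem' := by
    rintro σ ⟨η, h⟩
    refine ⟨fun x => (η x)⁻¹, fun a b => ?_⟩
    simp [h a b, mul_inv, mul_comm, mul_left_comm]

/-- The second cohomology group `H²(G, M)` (cocycles modulo coboundaries). -/
abbrev H2group (G M : Type*) [Group G] [CommGroup M] :=
  ↥(cocycles2 G M) ⧸ (coboundaries2 G M).subgroupOf (cocycles2 G M)

section H2

variable {G G' M : Type*} [Group G] [Group G'] [CommGroup M]

/-- Pullback of 2-cocycles along a group homomorphism. -/
def cocycles2Pullback (M : Type*) [CommGroup M] (φ : G' →* G) :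
    cocycles2 G M →* cocycles2 G' M where
  toFun σ := ⟨fun a b => σ.1 (φ a) (φ b), fun a b c => by
    simpa using σ.2 (φ a) (φ b) (φ c)⟩
  map_one' := rfl
  map_mul' _ _ := rfl

/-- Pullback of second cohomology classes along a group homomorphism. -/
def H2groupPullback (M : Type*) [CommGroup M] (φ : G' →* G) : H2group G M →* H2group G' M :=
  QuotientGroup.map _ _ (cocycles2Pullback M φ) <| by
    rintro σ ⟨η, hη⟩
    exact ⟨η ∘ φ, fun a b => by simpa [cocycles2Pullback] using hη (φ a) (φ b)⟩

lemma H2group_mk_eq_one_iff (σ : cocycles2 G M) :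
    (σ : H2group G M) = 1 ↔ ∃ η : G → M, ∀ a b, σ.1 a b = η a * η b * (η (a * b))⁻¹ :=
  QuotientGroup.eq_one_iff σ

lemma H2groupPullback_mk (φ : G' →* G) (σ : cocycles2 G M) :
    H2groupPullback M φ (σ : H2group G M) = (cocycles2Pullback M φ σ : H2group G' M) :=
  rfl

lemma H2groupPullback_comp {K : Type*} [Group K] (φ : G' →* G) (ψ : K →* G')
    (x : H2group G M) :
    H2groupPullback M ψ (H2groupPullback M φ x) = H2groupPullback M (φ.comp ψ) x := by
  induction x using QuotientGroup.induction_on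
  rfl

lemma H2groupPullback_id (x : H2group G M) : H2groupPullback M (MonoidHom.id G) x = x := by
  induction x using QuotientGroup.induction_on
  rfl

lemma H2groupPullback_one (x : H2group G M) : H2groupPullback M (1 : G' →* G) x = 1 := by
  induction x using QuotientGroup.induction_on with
  | H σ =>
    rw [H2groupPullback_mk, H2group_mk_eq_one_iff]
    exact ⟨fun _ => σ.1 1 1, fun a b => by simp [cocycles2Pullback]⟩

/-- The commutator pairing `σ(g, h) / σ(h, g)` attached to a 2-cocycle is multiplicative in `g`,
among elements commuting with `h`. -/
lemma cocycles2_pairing_mul_left {σ : G → G → M} (hσ : σ ∈ cocycles2 G M) {g g' h : G}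
    (hg : g * h = h * g) (hg' : g' * h = h * g') :
    σ (g * g') h / σ h (g * g') = σ g h / σ h g * (σ g' h / σ h g') := by
  have h₁ := hσ g g' h
  have h₂ := hσ h g g'
  have h₃ := hσ g h g'
  rw [hg'] at h₁
  rw [← hg] at h₂
  have e₁ : σ (g * g') h = σ g (h * g') * σ g' h / σ g g' := by
    rw [eq_div_iff_mul_eq', ← h₁, mul_comm]
  have e₂ : σ h (g * g') = σ h g * σ (g * h) g' / σ g g' := by
    rw [eq_div_iff_mul_eq', h₂]
  have e₃ : σ g (h * g') = σ g h * σ (g * h) g' / σ h g' := by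
    rw [eq_div_iff_mul_eq', h₃]
  rw [e₁, e₂, e₃, div_div_div_cancel_right, div_mul_div_comm, div_mul_eq_mul_div, div_div,
    div_eq_div_iff_mul_eq_mul]
  ac_rfl

/-- For commuting elements, the pairing `σ(g, h) / σ(h, g)` is killed by the order of `g`. -/
lemma cocycles2_pairing_pow_orderOf {σ : G → G → M} (hσ : σ ∈ cocycles2 G M) {g h : G}
    (hg : g * h = h * g) : (σ g h / σ h g) ^ orderOf g = 1 := by
  have h_one : σ 1 h / σ h 1 = 1 := by
    simpa using cocycles2_pairing_mul_left hσ (g := 1) (g' := 1) (h := h) (by simp) (by simp)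
  have h_pow (n : ℕ) : σ (g ^ n) h / σ h (g ^ n) = (σ g h / σ h g) ^ n := by
    induction n with
    | zero => simpa using h_one
    | succ n ih =>
      rw [pow_succ, cocycles2_pairing_mul_left hσ ((Commute.pow_left hg n).eq) hg, ih, pow_succ]
  rw [← h_pow, pow_orderOf_eq_one, h_one]

/-- A 2-cocycle is symmetric on commuting elements of coprime orders. -/
lemma cocycles2_symm_of_coprime {σ : G → G → M} (hσ : σ ∈ cocycles2 G M) {g h : G}
    (hg : g * h = h * g) (hc : (orderOf g).Coprime (orderOf h)) : σ g h = σ h g := by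
  have h₁ := cocycles2_pairing_pow_orderOf hσ hg
  have h₂ := cocycles2_pairing_pow_orderOf hσ hg.symm
  rw [← inv_div, inv_pow, inv_eq_one] at h₂
  have h₃ := Nat.dvd_gcd (orderOf_dvd_of_pow_eq_one h₁) (orderOf_dvd_of_pow_eq_one h₂)
  rw [hc.gcd_eq_one, Nat.dvd_one, orderOf_eq_one_iff] at h₃
  exact div_eq_one.mp h₃

lemma cocycles2_mul_mul {σ : G → G → M} (hσ : σ ∈ cocycles2 G M) {p h p' h' : G}
    (hc : p' * h = h * p') (hs : σ h p' = σ p' h) :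
    σ (p * h) (p' * h') * (σ p' h' * σ p h) =
      σ p p' * σ h h' * σ (p * p') (h * h') := by
  have h₁ := hσ (p * h) p' h'
  have h₂ := hσ p h p'
  have h₃ := hσ p p' h
  have h₄ := hσ (p * p') h h'
  rw [hs, ← hc, ← h₃] at h₂
  rw [mul_assoc p h p', ← hc, ← mul_assoc p p' h] at h₁
  calc _ = σ p h * (σ (p * h) (p' * h') * σ p' h') := by ac_rfl
    _ = (σ p h * σ (p * h) p') * σ (p * p' * h) h' := by rw [← h₁]; ac_rfl
    _ = σ p p' * (σ (p * p') h * σ (p * p' * h) h') := by rw [h₂]; ac_rfl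
    _ = _ := by rw [h₄]; ac_rfl

/-- The second cohomology of a direct product of finite groups of coprime orders, with trivial
coefficients, is the product of the second cohomology groups of the factors. -/
theorem H2group_prod_of_coprime {P H : Type*} [Group P] [Group H] (e : P × H ≃* G)
    (hc : (Nat.card P).Coprime (Nat.card H)) :
    Nonempty (H2group G M ≃* H2group P M × H2group H M) := by
  set i : P →* G := e.toMonoidHom.comp (MonoidHom.inl P H) with hi
  set j : H →* G := e.toMonoidHom.comp (MonoidHom.inr P H) with hj
  set q : G →* P := (MonoidHom.fst P H).comp e.symm.toMonoidHom with hq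
  set r : G →* H := (MonoidHom.snd P H).comp e.symm.toMonoidHom with hr
  have hqi : q.comp i = MonoidHom.id P := by ext; simp [hq, hi]
  have hrj : r.comp j = MonoidHom.id H := by ext; simp [hr, hj]
  have hqj : q.comp j = 1 := by ext; simp [hq, hj]
  have hri : r.comp i = 1 := by ext; simp [hr, hi]
  have hdecomp (g : G) : i (q g) * j (r g) = g := by
    apply e.symm.injective
    simp [hi, hj, hq, hr, ← map_mul]
  have hcomm (p : P) (h : H) : i p * j h = j h * i p := by
    simp [hi, hj, ← map_mul]
  refine ⟨MulEquiv.ofBijective ((H2groupPullback M i).prod (H2groupPullback M j)) ⟨?_, ?_⟩⟩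
  · rw [injective_iff_map_eq_one]
    intro x hx
    induction x using QuotientGroup.induction_on with
    | H σ =>
      simp only [MonoidHom.prod_apply, Prod.mk_eq_one, H2groupPullback_mk,
        H2group_mk_eq_one_iff] at hx
      obtain ⟨⟨a, ha⟩, b, hb⟩ := hx
      replace ha (x y : P) : σ.1 (i x) (i y) = a x * a y * (a (x * y))⁻¹ := ha x y
      replace hb (x y : H) : σ.1 (j x) (j y) = b x * b y * (b (x * y))⁻¹ := hb x y
      rw [H2group_mk_eq_one_iff]
      refine ⟨fun g => a (q g) * b (r g) * (σ.1 (i (q g)) (j (r g)))⁻¹, fun g g' => ?_⟩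
      have hsymm : σ.1 (j (r g)) (i (q g')) = σ.1 (i (q g')) (j (r g)) := by
        refine (cocycles2_symm_of_coprime σ.2 (hcomm _ _) ?_).symm
        exact (hc.coprime_dvd_left ((orderOf_map_dvd i _).trans (orderOf_dvd_natCard _))
          ).coprime_dvd_right ((orderOf_map_dvd j _).trans (orderOf_dvd_natCard _))
      have key := cocycles2_mul_mul σ.2 (p := i (q g)) (h' := j (r g')) (hcomm _ _) hsymm
      rw [hdecomp, hdecomp, ha, hb] at key
      simp only [← map_mul] at key
      rw [← eq_mul_inv_iff_mul_eq] at key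
      rw [key]
      simp only [mul_inv, inv_inv]
      ac_rfl
  · rintro ⟨x, y⟩
    refine ⟨H2groupPullback M q x * H2groupPullback M r y, ?_⟩
    simp [H2groupPullback_comp, hqi, hrj, hqj, hri, H2groupPullback_id, H2groupPullback_one]

end H2

/-- In a finite group, a subgroup whose elements are exactly those of odd order, and which is
central, is a direct complement of every Sylow 2-subgroup. -/
theorem exists_mulEquiv_sylow_two_prod {G : Type*} [Group G] [Finite G] {H : Subgroup G}
    (hH : ∀ x, x ∈ H ↔ Odd (orderOf x)) (hcen : H ≤ Subgroup.center G) (P : Sylow 2 G) :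
    ∃ e : (↥(P : Subgroup G) × ↥H) ≃* G, ∀ (p : ↥(P : Subgroup G)) (h : ↥H),
      e (p, h) = (p : G) * (h : G) := by
  have hcomm (p : (P : Subgroup G)) (h : H) : Commute ((P : Subgroup G).subtype p) (H.subtype h) :=
    Subgroup.mem_center_iff.mp (hcen h.2) p
  set m := MonoidHom.noncommCoprod (P : Subgroup G).subtype H.subtype hcomm with hm
  refine ⟨MulEquiv.ofBijective m ⟨?_, ?_⟩, fun p h => rfl⟩
  · rw [injective_iff_map_eq_one]
    rintro ⟨p, h⟩ hph
    have hp : (p : G) = (h : G)⁻¹ := eq_inv_of_mul_eq_one_left hph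
    obtain ⟨n, hn⟩ := IsPGroup.iff_orderOf.mp P.isPGroup' p
    have hodd := (hH _).mp (H.inv_mem h.2)
    rw [← hp, Subgroup.orderOf_coe, hn] at hodd
    have hn0 : n = 0 := by
      by_contra h0
      exact (Nat.not_even_iff_odd.mpr hodd) ((Nat.even_pow.mpr ⟨even_two, h0⟩))
    rw [hn0, pow_zero, orderOf_eq_one_iff] at hn
    subst hn
    simpa [Prod.ext_iff, eq_comm] using hp
  · have hPm : (P : Subgroup G) ≤ m.range := fun p hp => ⟨(⟨p, hp⟩, 1), by simp [hm]⟩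
    have hHm : H ≤ m.range := fun h hh => ⟨(1, ⟨h, hh⟩), by simp [hm]⟩
    have : H.Normal := ⟨fun h hh g => by
      rwa [Subgroup.mem_center_iff.mp (hcen hh) g, mul_inv_cancel_right]⟩
    have hquot : IsPGroup 2 (G ⧸ H) := by
      intro x
      induction x using QuotientGroup.induction_on with
      | H g =>
        obtain ⟨n, d, hd, hnd⟩ := Nat.exists_eq_two_pow_mul_odd (orderOf_pos g).ne'
        refine ⟨n, ?_⟩
        rw [← QuotientGroup.mk_pow, QuotientGroup.eq_one_iff, hH,
          orderOf_pow_of_dvd (by positivity) ⟨d, hnd⟩, hnd,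
          Nat.mul_div_cancel_left _ (by positivity)]
        exact hd
    obtain ⟨n, hn⟩ := IsPGroup.iff_card.mp hquot
    have hdvd : m.range.index ∣ 2 ^ n := hn ▸ Subgroup.index_dvd_of_le hHm
    have hcop : m.range.index.Coprime 2 :=
      Nat.Coprime.symm <| (Nat.prime_two.coprime_iff_not_dvd).mpr fun h =>
        P.not_dvd_index (h.trans (Subgroup.index_dvd_of_le hPm))
    rw [← MonoidHom.range_eq_top, ← Subgroup.index_eq_one]
    exact Nat.eq_one_of_dvd_coprimes (hcop.pow_right n) dvd_rfl hdvd

/-- For a finite group `G` with a central subgroup `Γ` such that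
`G/Γ ≅ ℤ/2 × ℤ/2`, the set `H` of elements of odd order is a subgroup contained
in `Γ`, `G ≅ P × H` for any Sylow 2-subgroup `P`, and
`H²(G, kˣ) ≅ H²(P, kˣ) × H²(H, kˣ)`. -/
theorem stmt_15 {k : Type*} [Field k] [IsAlgClosed k] [CharZero k]
    {G : Type*} [Group G] [Finite G]
    (Γ : Subgroup G) (hΓ : Γ ≤ Subgroup.center G)
    (f : G →* Multiplicative (ZMod 2) × Multiplicative (ZMod 2))
    (hf : Function.Surjective f) (hker : f.ker = Γ) :
    ∃ H : Subgroup G,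
      (H : Set G) = {x : G | Odd (orderOf x)} ∧
      H ≤ Γ ∧
      (∀ P : Sylow 2 G,
        ∃ e : (↥(P : Subgroup G) × ↥H) ≃* G,
          ∀ (p : ↥(P : Subgroup G)) (h : ↥H), e (p, h) = (p : G) * (h : G)) ∧
      (∀ P : Sylow 2 G,
        Nonempty (H2group G kˣ ≃* H2group (↥(P : Subgroup G)) kˣ × H2group (↥H) kˣ)) := by
  have hodd_mem {x : G} (hx : Odd (orderOf x)) : x ∈ Γ := by
    rw [← hker, MonoidHom.mem_ker]
    have hsq : ∀ y : Multiplicative (ZMod 2) × Multiplicative (ZMod 2), y ^ 2 = 1 := by decide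
    have h₁ : orderOf (f x) ∣ 2 := orderOf_dvd_of_pow_eq_one (hsq _)
    have h₂ := Nat.dvd_gcd h₁ (orderOf_map_dvd f x)
    rwa [(Nat.coprime_two_left.mpr hx).gcd_eq_one, Nat.dvd_one, orderOf_eq_one_iff] at h₂
  let H : Subgroup G :=
    { carrier := {x : G | Odd (orderOf x)}
      one_mem' := by simp
      mul_mem' := fun {x y} hx hy =>
        Odd.of_dvd_nat (Odd.mul hx hy) <| Commute.orderOf_mul_dvd_mul_orderOf
          (Subgroup.mem_center_iff.mp (hΓ (hodd_mem hy)) x)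
      inv_mem' := fun {x} hx => by simpa using hx }
  have hH (x : G) : x ∈ H ↔ Odd (orderOf x) := Iff.rfl
  have hHΓ : H ≤ Γ := fun x hx => hodd_mem hx
  have hprod := exists_mulEquiv_sylow_two_prod hH (hHΓ.trans hΓ)
  refine ⟨H, rfl, hHΓ, hprod, fun P => ?_⟩
  obtain ⟨e, -⟩ := hprod P
  refine H2group_prod_of_coprime e ?_
  obtain ⟨n, hn⟩ := IsPGroup.iff_card.mp P.isPGroup'
  rw [hn]
  refine Nat.Coprime.pow_left n ((Nat.prime_two.coprime_iff_not_dvd).mpr fun h2 => ?_)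
  obtain ⟨x, hx⟩ := exists_prime_orderOf_dvd_card' 2 h2
  have hx' := (hH x).mp x.2
  rw [Subgroup.orderOf_coe, hx] at hx'
  exact absurd hx' (by decide)
end

section
/- Let k be an algebraically closed field of characteristic 0 and let D be the dihedral group of order 8, generated by a rotation r of order 4 and a reflection s; set κ := r², the nontrivial central element of D. Then there exists a 2-cocycle σ on D with values in kˣ such that σ(s, κ)·σ(κ, s)⁻¹ = −1 and σ(r, κ)·σ(κ, r)⁻¹ = 1. -/
namespace DihedralGroup

/-- The homomorphism out of a dihedral group given by the images of the rotations and of the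
reflection `sr 0`. -/
def homOfAddChar {n : ℕ} {G : Type*} [Group G] (ρ : AddChar (ZMod n) G) (y : G)
    (hy : y * y = 1) (hρ : ∀ i, ρ i * y = y * ρ (-i)) : DihedralGroup n →* G where
  toFun
    | r i => ρ i
    | sr i => y * ρ i
  map_one' := ρ.map_zero_eq_one
  map_mul' a b := by
    rcases a with i | i <;> rcases b with j | j
    · exact ρ.map_add_eq_mul i j
    · change y * ρ (j - i) = ρ i * (y * ρ j)
      rw [← mul_assoc, hρ, mul_assoc, ← ρ.map_add_eq_mul, neg_add_eq_sub]
    · change y * ρ (i + j) = y * ρ i * ρ j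
      rw [ρ.map_add_eq_mul, mul_assoc]
    · change ρ (j - i) = y * ρ i * (y * ρ j)
      rw [mul_assoc, ← mul_assoc (ρ i), hρ, mul_assoc, ← mul_assoc, hy, one_mul,
        ← ρ.map_add_eq_mul, neg_add_eq_sub]

/-- The function on pairs of elements of a dihedral group attached to a character `χ` of the
rotations, trivial when the first argument is a rotation. -/
def cocycle {n : ℕ} {M : Type*} [CommGroup M] (χ : AddChar (ZMod n) M) :
    DihedralGroup n → DihedralGroup n → M
  | r _, _ => 1
  | sr _, r j => χ j
  | sr _, sr j => χ (-j)

theorem cocycle_mul {n : ℕ} {M : Type*} [CommGroup M] (χ : AddChar (ZMod n) M)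
    (a b c : DihedralGroup n) :
    cocycle χ a b * cocycle χ (a * b) c = cocycle χ a (b * c) * cocycle χ b c := by
  rcases a with i | i <;> rcases b with j | j <;> rcases c with l | l <;>
    simp [cocycle, ← AddChar.map_add_eq_mul, sub_eq_add_neg, add_comm]

end DihedralGroup

/-- A group of order `2 * n` generated by `x` and `y` subject to the dihedral relations is
the dihedral group. -/
theorem exists_mulEquiv_dihedralGroup {n : ℕ} [NeZero n] {G : Type*} [Group G] {x y : G}
    (hcard : Nat.card G = 2 * n) (hgen : Subgroup.closure {x, y} = ⊤)
    (hx : x ^ n = 1) (hy : y ^ 2 = 1) (hyx : y * x * y⁻¹ = x⁻¹) :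
    ∃ e : DihedralGroup n ≃* G, e (.r 1) = x ∧ e (.sr 0) = y := by
  let ρ : AddChar (ZMod n) G :=
    { toFun i := x ^ i.val
      map_zero_eq_one' := by simp
      map_add_eq_mul' i j := by rw [ZMod.val_add, ← pow_eq_pow_mod _ hx, pow_add] }
  have hρ_one : ρ 1 = x := by
    change x ^ (1 : ZMod n).val = x
    rw [← Nat.cast_one, ZMod.val_natCast, ← pow_eq_pow_mod 1 hx, pow_one]
  have hρ (i : ZMod n) : ρ i * y = y * ρ (-i) := by
    have hconj : y * ρ (-i) * y⁻¹ = ρ i := by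
      rw [AddChar.map_neg_eq_inv, ← conj_inv]
      change (y * x ^ i.val * y⁻¹)⁻¹ = x ^ i.val
      rw [← conj_pow, hyx, inv_pow, inv_inv]
    rw [← hconj, inv_mul_cancel_right]
  let f := DihedralGroup.homOfAddChar ρ y (by rw [← sq, hy]) hρ
  have hfr : f (.r 1) = x := hρ_one
  have hfs : f (.sr 0) = y := by
    change y * ρ 0 = y
    rw [AddChar.map_zero_eq_one, mul_one]
  have hsurj : Function.Surjective f := by
    rw [← MonoidHom.range_eq_top, eq_top_iff, ← hgen, Subgroup.closure_le]
    rintro z (rfl | rfl)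
    exacts [⟨_, hfr⟩, ⟨_, hfs⟩]
  have hbij : Function.Bijective f :=
    (Nat.bijective_iff_surjective_and_card f).2
      ⟨hsurj, by rw [hcard, DihedralGroup.nat_card]⟩
  exact ⟨MulEquiv.ofBijective f hbij, hfr, hfs⟩

/-- On the dihedral group of order 8 (presented by `r⁴ = s² = 1`,
`s·r·s⁻¹ = r⁻¹`, with `κ = r²` the nontrivial central element) there is a
2-cocycle `σ` with `σ(s,κ)·σ(κ,s)⁻¹ = −1` and `σ(r,κ)·σ(κ,r)⁻¹ = 1`. -/
theorem stmt_16 {k : Type*} [Field k] [IsAlgClosed k] [CharZero k]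
    {D : Type*} [Group D] (r s : D)
    (hcard : Nat.card D = 8)
    (hgen : Subgroup.closure {r, s} = ⊤)
    (hr : r ^ 4 = 1) (hs : s ^ 2 = 1) (hrs : s * r * s⁻¹ = r⁻¹) :
    ∃ σ : D → D → kˣ,
      (∀ a b c : D, σ a b * σ (a * b) c = σ a (b * c) * σ b c) ∧
      σ s (r ^ 2) * (σ (r ^ 2) s)⁻¹ = -1 ∧
      σ r (r ^ 2) * (σ (r ^ 2) r)⁻¹ = 1 := by
  obtain ⟨i, hi⟩ := IsAlgClosed.exists_pow_nat_eq (-1 : k) (n := 2) (by norm_num)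
  have hi0 : i ≠ 0 := by
    rintro rfl
    norm_num at hi
  let ζ : kˣ := Units.mk0 i hi0
  have hζ2 : ζ ^ 2 = -1 := Units.ext (by simpa [ζ] using hi)
  have hζ4 : ζ ^ 4 = 1 := by rw [show 4 = 2 * 2 from rfl, pow_mul, hζ2]; norm_num
  obtain ⟨e, her, hes⟩ := exists_mulEquiv_dihedralGroup (n := 4) hcard hgen hr hs hrs
  have hr' : e.symm r = .r 1 := by rw [← her, e.symm_apply_apply]
  have hs' : e.symm s = .sr 0 := by rw [← hes, e.symm_apply_apply]
  have hκ' : e.symm (r ^ 2) = .r 2 := by rw [map_pow, hr', DihedralGroup.r_one_pow]; rfl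
  let χ := AddChar.zmodChar 4 hζ4
  have hχ : χ 2 = -1 := hζ2
  refine ⟨fun a b => DihedralGroup.cocycle χ (e.symm a) (e.symm b), fun a b c => ?_, ?_, ?_⟩
  · simpa only [map_mul] using DihedralGroup.cocycle_mul χ (e.symm a) (e.symm b) (e.symm c)
  · simp only [hs', hκ', DihedralGroup.cocycle, hχ, inv_one, mul_one]
  · simp only [hr', hκ', DihedralGroup.cocycle, inv_one, mul_one]
end

section
/- Let k be an algebraically closed field of characteristic 0. Let C₄ = ⟨x⟩ be the cyclic group of order 4, let V = ⟨κ⟩ × ⟨y⟩ be the Klein four group with generators κ and y, and let G := C₄ ⋉ V be the semidirect product of order 16 in which x acts on V by fixing κ and sending y to κ·y. Then there exists a 2-cocycle σ on G with values in kˣ such that σ(x, κ)·σ(κ, x)⁻¹ = −1, σ(y, κ)·σ(κ, y)⁻¹ = 1, and σ(y, x²)·σ(x², y)⁻¹ = −1. -/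
/-- The exponent of `-1` in the cocycle, on coordinates `(i, j, l)` standing for
`κ ^ j * y ^ l * x ^ i`. -/
def cocycleExponent (a b : ZMod 4 × ZMod 2 × ZMod 2) : ZMod 2 :=
  a.1.cast * b.2.1 + (a.1.val.choose 2 : ℕ) * b.2.2

/-- The multiplication of `C₄ ⋉ (ℤ/2 × ℤ/2)` in the coordinates `(i, j, l)`. -/
def coordMul (a b : ZMod 4 × ZMod 2 × ZMod 2) : ZMod 4 × ZMod 2 × ZMod 2 :=
  (a.1 + b.1, a.2.1 + b.2.1 + a.1.cast * b.2.2, a.2.2 + b.2.2)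

theorem zmod_four_cast_add (i j : ZMod 4) :
    ((i + j).cast : ZMod 2) = i.cast + j.cast := by
  revert i j; decide

theorem zmod_four_choose_two_add (i j : ZMod 4) :
    (((i + j).val.choose 2 : ℕ) : ZMod 2) =
      (i.val.choose 2 : ℕ) + (j.val.choose 2 : ℕ) + i.cast * j.cast := by
  revert i j; decide

theorem cocycleExponent_cocycle (a b c : ZMod 4 × ZMod 2 × ZMod 2) :
    cocycleExponent a b + cocycleExponent (coordMul a b) c =
      cocycleExponent a (coordMul b c) + cocycleExponent b c := by
  simp only [cocycleExponent, coordMul, zmod_four_cast_add, zmod_four_choose_two_add]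
  ring

theorem pow_zmod_val_add {M : Type*} [Monoid M] {n : ℕ} [NeZero n] {g : M} (hg : g ^ n = 1)
    (a b : ZMod n) : g ^ (a + b).val = g ^ a.val * g ^ b.val := by
  rw [ZMod.val_add, ← pow_eq_pow_mod _ hg, pow_add]

theorem pow_mul_pow_of_mul_eq {M : Type*} [Monoid M] {x y κ : M} (hκ : ∀ g, Commute κ g)
    (h : x * y = κ * y * x) (m n : ℕ) : x ^ m * y ^ n = κ ^ (m * n) * y ^ n * x ^ m := by
  have h1 : ∀ n : ℕ, SemiconjBy x (y ^ n) (κ ^ n * y ^ n) := fun n => by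
    rw [← (hκ y).mul_pow]
    exact SemiconjBy.pow_right h n
  induction m with
  | zero => simp
  | succ m ih =>
    have h2 : x * κ ^ (m * n) = κ ^ (m * n) * x := ((hκ x).pow_left _).eq.symm
    calc x ^ (m + 1) * y ^ n = x * (x ^ m * y ^ n) := by rw [pow_succ', mul_assoc]
      _ = x * κ ^ (m * n) * y ^ n * x ^ m := by rw [ih]; simp only [mul_assoc]
      _ = κ ^ (m * n) * (x * y ^ n) * x ^ m := by rw [h2]; simp only [mul_assoc]
      _ = κ ^ (m * n) * (κ ^ n * y ^ n * x) * x ^ m := by rw [(h1 n).eq]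
      _ = κ ^ ((m + 1) * n) * y ^ n * x ^ (m + 1) := by
        rw [add_mul, one_mul, pow_add, pow_succ' x]; simp only [mul_assoc]

/-- The element with coordinates `(i, j, l)`. -/
def ofCoords {M : Type*} [Monoid M] (x y κ : M) (a : ZMod 4 × ZMod 2 × ZMod 2) : M :=
  κ ^ a.2.1.val * y ^ a.2.2.val * x ^ a.1.val

theorem ofCoords_coordMul {M : Type*} [Monoid M] {x y κ : M}
    (hx : x ^ 4 = 1) (hy : y ^ 2 = 1) (hκ2 : κ ^ 2 = 1) (hκ : ∀ g, Commute κ g)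
    (h : x * y = κ * y * x) (a b : ZMod 4 × ZMod 2 × ZMod 2) :
    ofCoords x y κ (coordMul a b) = ofCoords x y κ a * ofCoords x y κ b := by
  obtain ⟨i, j, l⟩ := a
  obtain ⟨i', j', l'⟩ := b
  have hv : κ ^ ((i.cast : ZMod 2) * l').val = κ ^ (i.val * l'.val) := by
    rw [pow_eq_pow_mod (i.val * l'.val) hκ2]
    congr 1
    revert i l'; decide
  have hc : ∀ n g, g * κ ^ n = κ ^ n * g := fun n g => ((hκ g).pow_left n).eq.symm
  simp only [ofCoords, coordMul]
  rw [pow_zmod_val_add hx, pow_zmod_val_add hy, pow_zmod_val_add hκ2, pow_zmod_val_add hκ2, hv]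
  symm
  calc κ ^ j.val * y ^ l.val * x ^ i.val * (κ ^ j'.val * y ^ l'.val * x ^ i'.val)
      = κ ^ j.val * (y ^ l.val * x ^ i.val * κ ^ j'.val) * y ^ l'.val * x ^ i'.val := by
        simp only [mul_assoc]
    _ = κ ^ j.val * κ ^ j'.val * y ^ l.val * (x ^ i.val * y ^ l'.val) * x ^ i'.val := by
        rw [hc]; simp only [mul_assoc]
    _ = κ ^ j.val * κ ^ j'.val * (y ^ l.val * κ ^ (i.val * l'.val)) * y ^ l'.val * x ^ i.val *
          x ^ i'.val := by
        rw [pow_mul_pow_of_mul_eq hκ h]; simp only [mul_assoc]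
    _ = κ ^ j.val * κ ^ j'.val * κ ^ (i.val * l'.val) * (y ^ l.val * y ^ l'.val) *
          (x ^ i.val * x ^ i'.val) := by
        rw [hc _ (y ^ l.val)]; simp only [mul_assoc]

theorem ofCoords_bijective {G : Type*} [Group G] {x y κ : G}
    (hcard : Nat.card G = 16) (hgen : Subgroup.closure {x, y, κ} = ⊤)
    (hmul : ∀ a b, ofCoords x y κ (coordMul a b) = ofCoords x y κ a * ofCoords x y κ b) :
    Function.Bijective (ofCoords x y κ) := by
  have : Finite G := Nat.finite_of_card_ne_zero (by omega)
  have hsurj : Function.Surjective (ofCoords x y κ) := fun g => by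
    have hg : g ∈ Submonoid.closure {x, y, κ} := by
      rw [← Subgroup.closure_toSubmonoid_of_finite, hgen]
      exact Subgroup.mem_top g
    induction hg using Submonoid.closure_induction with
    | mem g hg =>
      obtain rfl | rfl | rfl := hg
      · exact ⟨(1, 0, 0), by simp [ofCoords, ZMod.val_one'']⟩
      · exact ⟨(0, 0, 1), by simp [ofCoords, ZMod.val_one'']⟩
      · exact ⟨(0, 1, 0), by simp [ofCoords, ZMod.val_one'']⟩
    | one => exact ⟨(0, 0, 0), by simp [ofCoords]⟩
    | mul g g' _ _ hg hg' =>
      obtain ⟨a, rfl⟩ := hg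
      obtain ⟨b, rfl⟩ := hg'
      exact ⟨coordMul a b, hmul a b⟩
  exact hsurj.bijective_of_nat_card_le (by simp [hcard])


/-- On the group `G = C₄ ⋉ (ℤ/2 × ℤ/2)` of order 16 (presented by `x⁴ = y² = κ² = 1`,
`κ` central, `x·y·x⁻¹ = κ·y`) there is a 2-cocycle `σ` with
`σ(x,κ)·σ(κ,x)⁻¹ = −1`, `σ(y,κ)·σ(κ,y)⁻¹ = 1` and `σ(y,x²)·σ(x²,y)⁻¹ = −1`. -/
theorem stmt_18 {k : Type*} [Field k] [IsAlgClosed k] [CharZero k]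
    {G : Type*} [Group G] (x y κ : G)
    (hcard : Nat.card G = 16)
    (hgen : Subgroup.closure {x, y, κ} = ⊤)
    (hx : x ^ 4 = 1) (hy : y ^ 2 = 1) (hκ2 : κ ^ 2 = 1)
    (hκc : ∀ g : G, κ * g = g * κ)
    (hconj : x * y * x⁻¹ = κ * y) :
    ∃ σ : G → G → kˣ,
      (∀ a b c : G, σ a b * σ (a * b) c = σ a (b * c) * σ b c) ∧
      σ x κ * (σ κ x)⁻¹ = -1 ∧
      σ y κ * (σ κ y)⁻¹ = 1 ∧
      σ y (x ^ 2) * (σ (x ^ 2) y)⁻¹ = -1 := by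
  have hκ : ∀ g, Commute κ g := hκc
  have hxy : x * y = κ * y * x := by rw [← hconj, inv_mul_cancel_right]
  have hmul := ofCoords_coordMul hx hy hκ2 hκ hxy
  let e := Equiv.ofBijective _ (ofCoords_bijective hcard hgen hmul)
  have he : ∀ g h : G, e.symm (g * h) = coordMul (e.symm g) (e.symm h) := fun g h => by
    rw [Equiv.symm_apply_eq]
    refine Eq.trans ?_ (hmul _ _).symm
    exact congrArg₂ _ (e.apply_symm_apply g).symm (e.apply_symm_apply h).symm
  have hex : e.symm x = (1, 0, 0) := by
    rw [Equiv.symm_apply_eq]; simp [e, ofCoords, ZMod.val_one'']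
  have hey : e.symm y = (0, 0, 1) := by
    rw [Equiv.symm_apply_eq]; simp [e, ofCoords, ZMod.val_one'']
  have heκ : e.symm κ = (0, 1, 0) := by
    rw [Equiv.symm_apply_eq]; simp [e, ofCoords, ZMod.val_one'']
  have hexx : e.symm (x ^ 2) = (2, 0, 0) := by
    rw [pow_two, he, hex]; decide
  have hsq : (-1 : kˣ) ^ 2 = 1 := by simp
  refine ⟨fun a b => (-1) ^ (cocycleExponent (e.symm a) (e.symm b)).val,
    fun a b c => ?_, ?_, ?_, ?_⟩
  · simp only [he, ← pow_zmod_val_add hsq, cocycleExponent_cocycle]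
  · have h1 : (cocycleExponent (1, 0, 0) (0, 1, 0)).val = 1 := by decide
    have h2 : (cocycleExponent (0, 1, 0) (1, 0, 0)).val = 0 := by decide
    simp [hex, heκ, h1, h2]
  · have h1 : (cocycleExponent (0, 0, 1) (0, 1, 0)).val = 0 := by decide
    have h2 : (cocycleExponent (0, 1, 0) (0, 0, 1)).val = 0 := by decide
    simp [hey, heκ, h1, h2]
  · have h1 : (cocycleExponent (0, 0, 1) (2, 0, 0)).val = 0 := by decide
    have h2 : (cocycleExponent (2, 0, 0) (0, 0, 1)).val = 1 := by decide
    simp [hey, hexx, h1, h2]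
end

section
/- Let 𝕜 be an algebraically closed field of characteristic 0, let t ≥ 1 be an integer and K := 4t. Let G := C_{2K} ⋉ C_{2K} be the semidirect product of two cyclic groups of order 2K with generators x and y, where x acts by sending y to y^{K+1} (so that x·y·x⁻¹·y⁻¹ = y^K, and κ := y^K is a central element of order 2). Then there exists a 2-cocycle σ on G with values in 𝕜ˣ such that σ(x, y^K)·σ(y^K, x)⁻¹ = −1 and σ(y, y^K)·σ(y^K, y)⁻¹ = 1. -/
/-- The geometric sum `n ↦ ∑_{i < n} u ^ i` satisfies the crossed additivity rule. -/
theorem geom_sum_add_crossed (u m n : ℕ) :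
    ∑ i ∈ Finset.range (m + n), u ^ i =
      ∑ i ∈ Finset.range n, u ^ i + (∑ i ∈ Finset.range m, u ^ i) * u ^ n := by
  rw [add_comm m n, Finset.sum_range_add, Finset.sum_mul]
  simp [pow_add, mul_comm]

theorem succ_sq_modEq_one {K : ℕ} (hK : Even K) : (K + 1) ^ 2 ≡ 1 [MOD 2 * K] := by
  obtain ⟨r, rfl⟩ := hK
  refine ((Nat.modEq_iff_dvd' (Nat.one_le_pow _ _ (by omega))).2 ⟨r + 1, ?_⟩).symm
  have : (r + r + 1) ^ 2 = 2 * (r + r) * (r + 1) + 1 := by ring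
  omega

theorem succ_pow_modEq_one {K : ℕ} (hK : Even K) : (K + 1) ^ (2 * K) ≡ 1 [MOD 2 * K] := by
  rw [pow_mul]
  simpa using (succ_sq_modEq_one hK).pow K

theorem geom_sum_two_mul_modEq {K : ℕ} (hK : Even K) (m : ℕ) :
    ∑ i ∈ Finset.range (2 * m), (K + 1) ^ i ≡ m * (K + 2) [MOD 2 * K] := by
  induction m with
  | zero => simp [Nat.ModEq]
  | succ m ih =>
    rw [show 2 * (m + 1) = 2 + 2 * m by ring, geom_sum_add_crossed]
    have h1 : (K + 1) ^ (2 * m) ≡ 1 [MOD 2 * K] := by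
      rw [pow_mul]
      simpa using (succ_sq_modEq_one hK).pow m
    have h2 := ih.add (h1.mul_left (K + 2))
    have h3 : ∑ i ∈ Finset.range 2, (K + 1) ^ i = K + 2 := by
      simp [Finset.sum_range_succ]; ring
    rw [h3]
    convert h2 using 1
    ring

theorem geom_sum_period_modEq {K : ℕ} (hK : Even K) :
    ∑ i ∈ Finset.range (2 * K), (K + 1) ^ i ≡ 0 [MOD 2 * K] := by
  refine (geom_sum_two_mul_modEq hK K).trans ((Nat.modEq_zero_iff_dvd).2 ?_)
  obtain ⟨r, rfl⟩ := hK
  exact ⟨r + 1, by ring⟩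

theorem geom_sum_mod_modEq {K : ℕ} (hK : Even K) (n : ℕ) :
    ∑ i ∈ Finset.range n, (K + 1) ^ i ≡
      ∑ i ∈ Finset.range (n % (2 * K)), (K + 1) ^ i [MOD 2 * K] := by
  have key : ∀ q r : ℕ, ∑ i ∈ Finset.range (r + 2 * K * q), (K + 1) ^ i ≡
      ∑ i ∈ Finset.range r, (K + 1) ^ i [MOD 2 * K] := by
    intro q r
    induction q with
    | zero => simp [Nat.ModEq.refl]
    | succ q ih =>
      rw [mul_add_one, ← add_assoc, geom_sum_add_crossed]
      simpa using (geom_sum_period_modEq hK).add (ih.mul (succ_pow_modEq_one hK))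
  conv_lhs => rw [← Nat.mod_add_div n (2 * K)]
  exact key _ _

theorem geom_sum_congr_modEq {K : ℕ} (hK : Even K) {m n : ℕ} (h : m ≡ n [MOD 2 * K]) :
    ∑ i ∈ Finset.range m, (K + 1) ^ i ≡ ∑ i ∈ Finset.range n, (K + 1) ^ i [MOD 2 * K] := by
  have hm := geom_sum_mod_modEq hK m
  rw [show m % (2 * K) = n % (2 * K) from h] at hm
  exact hm.trans (geom_sum_mod_modEq hK n).symm

section Metacyclic

variable {G : Type*} [Group G] {x y : G}

theorem pow_mul_pow_of_conj_eq_pow {u : ℕ} (h : x * y * x⁻¹ = y ^ u) (b a : ℕ) :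
    x ^ b * y ^ a = y ^ (a * u ^ b) * x ^ b := by
  have h1 (n : ℕ) : x * y ^ n = y ^ (n * u) * x := by
    rw [mul_comm n u, pow_mul, ← h, conj_pow]
    group
  induction b with
  | zero => simp
  | succ b ih =>
    rw [pow_succ', mul_assoc, ih, ← mul_assoc, h1, mul_assoc, pow_succ, ← mul_assoc a]

theorem pow_mul_pow_mul_pow_mul_pow_of_conj_eq_pow {u : ℕ} (h : x * y * x⁻¹ = y ^ u)
    (a b c d : ℕ) :
    y ^ a * x ^ b * (y ^ c * x ^ d) = y ^ (a + c * u ^ b) * x ^ (b + d) := by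
  rw [mul_assoc, ← mul_assoc (x ^ b), pow_mul_pow_of_conj_eq_pow h, pow_add, pow_add]
  simp only [mul_assoc]

theorem exists_eq_pow_mul_pow {u N : ℕ} (hN : 0 < N) (h : x * y * x⁻¹ = y ^ u)
    (hx : x ^ N = 1) (hy : y ^ N = 1) (hgen : Subgroup.closure {x, y} = ⊤) (g : G) :
    ∃ a b : ℕ, g = y ^ a * x ^ b := by
  have inv_pow_eq {z : G} (hz : z ^ N = 1) (n : ℕ) : (z ^ n)⁻¹ = z ^ ((N - 1) * n) := by
    rw [inv_eq_iff_mul_eq_one, ← pow_add, ← one_add_mul, Nat.add_sub_cancel' (show 1 ≤ N from hN), pow_mul, hz,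
      one_pow]
  have hg : g ∈ Subgroup.closure {x, y} := hgen ▸ Subgroup.mem_top g
  induction hg using Subgroup.closure_induction with
  | mem z hz =>
    rcases hz with rfl | rfl
    · exact ⟨0, 1, by simp⟩
    · exact ⟨1, 0, by simp⟩
  | one => exact ⟨0, 0, by simp⟩
  | mul g₁ g₂ _ _ h₁ h₂ =>
    obtain ⟨a, b, rfl⟩ := h₁
    obtain ⟨c, d, rfl⟩ := h₂
    exact ⟨_, _, pow_mul_pow_mul_pow_mul_pow_of_conj_eq_pow h a b c d⟩
  | inv g _ hg =>
    obtain ⟨a, b, rfl⟩ := hg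
    rw [mul_inv_rev, inv_pow_eq hx, inv_pow_eq hy, pow_mul_pow_of_conj_eq_pow h]
    exact ⟨_, _, rfl⟩

theorem modEq_of_pow_mul_pow_eq {N : ℕ} (hN : 0 < N)
    (hx : x ^ N = 1) (hy : y ^ N = 1) (hcard : Nat.card G = N ^ 2)
    (hsurj : ∀ g : G, ∃ a b : ℕ, g = y ^ a * x ^ b) {a b c d : ℕ}
    (h : y ^ a * x ^ b = y ^ c * x ^ d) : a ≡ c [MOD N] ∧ b ≡ d [MOD N] := by
  have : Finite G := Nat.finite_of_card_ne_zero (by rw [hcard]; positivity)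
  let f : Fin N × Fin N → G := fun p => y ^ (p.1 : ℕ) * x ^ (p.2 : ℕ)
  have hf (a b : ℕ) :
      f (⟨a % N, Nat.mod_lt _ hN⟩, ⟨b % N, Nat.mod_lt _ hN⟩) = y ^ a * x ^ b := by
    simp only [f]
    rw [← pow_eq_pow_mod a hy, ← pow_eq_pow_mod b hx]
  have fsurj : Function.Surjective f := fun g => by
    obtain ⟨a, b, rfl⟩ := hsurj g
    exact ⟨_, hf a b⟩
  have fbij : Function.Bijective f := fsurj.bijective_of_nat_card_le (by simp [hcard, sq])
  have := fbij.1 ((hf a b).trans (h.trans (hf c d).symm))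
  simpa [Nat.ModEq] using this

end Metacyclic


/-- For `K = 4t`, on the group `G = C_{2K} ⋉ C_{2K}` (presented by
`x^{2K} = y^{2K} = 1`, `x·y·x⁻¹ = y^{K+1}`, so `κ = y^K` is central of order 2)
there is a 2-cocycle `σ` with `σ(x, y^K)·σ(y^K, x)⁻¹ = −1` and
`σ(y, y^K)·σ(y^K, y)⁻¹ = 1`. -/
theorem stmt_19 {k : Type*} [Field k] [IsAlgClosed k] [CharZero k]
    (t : ℕ) (ht : 1 ≤ t) (K : ℕ) (hK : K = 4 * t)
    {G : Type*} [Group G] (x y : G)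
    (hcard : Nat.card G = 4 * K ^ 2)
    (hgen : Subgroup.closure {x, y} = ⊤)
    (hx : x ^ (2 * K) = 1) (hy : y ^ (2 * K) = 1)
    (hconj : x * y * x⁻¹ = y ^ (K + 1)) :
    ∃ σ : G → G → kˣ,
      (∀ a b c : G, σ a b * σ (a * b) c = σ a (b * c) * σ b c) ∧
      σ x (y ^ K) * (σ (y ^ K) x)⁻¹ = -1 ∧
      σ y (y ^ K) * (σ (y ^ K) y)⁻¹ = 1 := by
  have hKpos : 0 < K := by omega
  have hN : 0 < 2 * K := by omega
  have hKe : Even K := ⟨2 * t, by omega⟩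
  have hsurj := exists_eq_pow_mul_pow hN hconj hx hy hgen
  have huniq {a b c d : ℕ} (h : y ^ a * x ^ b = y ^ c * x ^ d) :
      a ≡ c [MOD 2 * K] ∧ b ≡ d [MOD 2 * K] :=
    modEq_of_pow_mul_pow_eq hN hx hy (by rw [hcard]; ring) hsurj h
  choose α β hαβ using hsurj
  have hcoord {g : G} {a b : ℕ} (h : g = y ^ a * x ^ b) :
      α g ≡ a [MOD 2 * K] ∧ β g ≡ b [MOD 2 * K] :=
    huniq ((hαβ g).symm.trans h)
  have hmul (g h : G) : α (g * h) ≡ α g + α h * (K + 1) ^ β g [MOD 2 * K] ∧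
      β (g * h) ≡ β g + β h [MOD 2 * K] := by
    apply hcoord
    rw [← pow_mul_pow_mul_pow_mul_pow_of_conj_eq_pow hconj, ← hαβ, ← hαβ]
  have : NeZero (2 * K) := ⟨hN.ne'⟩
  obtain ⟨z, hz⟩ := HasEnoughRootsOfUnity.exists_primitiveRoot k (2 * K)
  let ζ : kˣ := (hz.isUnit hN.ne').unit
  have hζ : ζ ^ (2 * K) = 1 := Units.ext (by simpa [ζ] using hz.pow_eq_one)
  have hζK : ζ ^ K = -1 := by
    have h1 : z ^ K ≠ 1 := hz.pow_ne_one_of_pos_of_lt hKpos.ne' (by omega)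
    have h2 : (z ^ K) ^ 2 = 1 := by rw [← pow_mul, mul_comm, hz.pow_eq_one]
    exact Units.ext (by simpa [ζ] using (mul_self_eq_one_iff.1 ((sq _).symm.trans h2)).resolve_left h1)
  let D : ℕ → ℕ := fun b => ∑ i ∈ Finset.range b, (K + 1) ^ i
  have hσ {g h : G} {a b c d : ℕ} (hg : g = y ^ a * x ^ b) (hh : h = y ^ c * x ^ d) :
      ζ ^ (D (β g) * α h) = ζ ^ (D b * c) :=
    pow_eq_pow_of_modEq ((geom_sum_congr_modEq hKe (hcoord hg).2).mul (hcoord hh).1) hζ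
  refine ⟨fun g h => ζ ^ (D (β g) * α h), fun g h l => ?_, ?_, ?_⟩
  · simp only [← pow_add]
    refine pow_eq_pow_of_modEq ?_ hζ
    have h1 := ((geom_sum_congr_modEq hKe (hmul g h).2).mul_right (α l)).add_left (D (β g) * α h)
    have h2 := ((hmul h l).1.mul_left (D (β g))).add_right (D (β h) * α l)
    refine h1.trans (Nat.ModEq.trans ?_ h2.symm)
    rw [geom_sum_add_crossed]
    simp only [D]
    ring_nf
    rfl
  · have h1 := hσ (g := x) (h := y ^ K) (a := 0) (b := 1) (c := K) (d := 0) (by simp) (by simp)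
    have h2 := hσ (g := y ^ K) (h := x) (a := K) (b := 0) (c := 0) (d := 1) (by simp) (by simp)
    simp only [h1, h2]
    simp [D, hζK]
  · have h1 := hσ (g := y) (h := y ^ K) (a := 1) (b := 0) (c := K) (d := 0) (by simp) (by simp)
    have h2 := hσ (g := y ^ K) (h := y) (a := K) (b := 0) (c := 1) (d := 0) (by simp) (by simp)
    simp only [h1, h2]
    simp [D]
end
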